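/- Let p > 1, q > 1, T > 0. For every k ∈ (0,1) and every n ∈ ℕ (n ≥ 1), the pair λ_n(k) = (q/p*)·(1+k^q)·(2k^q/(1+k^q))^{p/q−1}·(2nK_{pq}(k)/T)^p and u_{n,k}(t) = (2k^q/(1+k^q))^{1/q}·sn_{pq}(2nK_{pq}(k)t/T, k) is an eigenpair: u_{n,k} and −u_{n,k} are nontrivial classical solutions of (φ_p(u'))' + λ_n(k)·φ_q(u)·(1−|u|^q) = 0 on (0,T) with u(0) = u(T) = 0, and |u_{n,k}(t)| < 1 for all t. Conversely: if 1 < p ≤ 2, every nontrivial classical solution (λ, u) of this boundary value problem is of the form λ = λ_n(k), u = ±u_{n,k} for some n ≥ 1 and k ∈ (0,1); and if p > 2, every nontrivial classical solution (λ, u) satisfying |u(t)| < 1 for all t ∈ [0,T] is of this form. -/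

import Mathlib

open Real Set Filter MeasureTheory

/-- Generalized arcsine: `arcsin_{pq}(σ) = ∫_0^σ (1 - s^q)^(-1/p) ds`. -/
noncomputable def arcsinPQ (p q σ : ℝ) : ℝ :=
  ∫ s in (0:ℝ)..σ, (1 - s ^ q) ^ (-(1 / p))

/-- The generalized half-period `π_{pq} = 2 arcsin_{pq}(1)`. -/
noncomputable def piPQ (p q : ℝ) : ℝ := 2 * arcsinPQ p q 1

/-- Generalized incomplete elliptic integral:
`arcsn_{pq}(σ,k) = ∫_0^σ ((1-s^q)(1-k^q s^q))^(-1/p) ds`. -/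
noncomputable def arcsnPQ (p q k σ : ℝ) : ℝ :=
  ∫ s in (0:ℝ)..σ, ((1 - s ^ q) * (1 - k ^ q * s ^ q)) ^ (-(1 / p))

/-- Generalized complete elliptic integral `K_{pq}(k) = arcsn_{pq}(1,k)`. -/
noncomputable def Kpq (p q k : ℝ) : ℝ := arcsnPQ p q k 1

/-- `φ_m(s) = |s|^(m-2) s` for `s ≠ 0`, `φ_m(0) = 0`. -/
noncomputable def phi (m s : ℝ) : ℝ := if s = 0 then 0 else |s| ^ (m - 2) * s

/-- Incomplete beta function `B̃(a,b,u) = ∫_0^u z^(a-1) (1-z)^(b-1) dz`. -/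
noncomputable def incBeta (a b u : ℝ) : ℝ :=
  ∫ z in (0:ℝ)..u, z ^ (a - 1) * (1 - z) ^ (b - 1)

/-- A classical solution of `(φ_p(u'))' + λ φ_q(u) = 0` on `(0,T)` with
`u(0) = u(T) = 0`: `u ∈ C¹([0,T])`, `t ↦ φ_p(u'(t))` is differentiable on `(0,T)`
and the equation holds at every point of `(0,T)`. -/
def IsSolE (p q T lam : ℝ) (u : ℝ → ℝ) : Prop :=
  ∃ u' : ℝ → ℝ,
    (∀ t ∈ Set.Icc 0 T, HasDerivWithinAt u (u' t) (Set.Icc 0 T) t) ∧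
    ContinuousOn u' (Set.Icc 0 T) ∧
    (∀ t ∈ Set.Ioo 0 T, HasDerivWithinAt (fun s => phi p (u' s))
      (-(lam * phi q (u t))) (Set.Ioo 0 T) t) ∧
    u 0 = 0 ∧ u T = 0

/-- A classical solution of `(φ_p(u'))' + λ φ_q(u)(1 - |u|^q) = 0` on `(0,T)` with
`u(0) = u(T) = 0`. -/
def IsSolP (p q T lam : ℝ) (u : ℝ → ℝ) : Prop :=
  ∃ u' : ℝ → ℝ,
    (∀ t ∈ Set.Icc 0 T, HasDerivWithinAt u (u' t) (Set.Icc 0 T) t) ∧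
    ContinuousOn u' (Set.Icc 0 T) ∧
    (∀ t ∈ Set.Ioo 0 T, HasDerivWithinAt (fun s => phi p (u' s))
      (-(lam * phi q (u t) * (1 - |u t| ^ q))) (Set.Ioo 0 T) t) ∧
    u 0 = 0 ∧ u T = 0

/-- `Φ(k) = (1+k^q)^(1/p) (2k^q/(1+k^q))^(1/q - 1/p) K_{pq}(k)`. -/
noncomputable def PhiFun (p q k : ℝ) : ℝ :=
  (1 + k ^ q) ^ (1 / p) * (2 * k ^ q / (1 + k ^ q)) ^ (1 / q - 1 / p) * Kpq p q k

lemma phi_eq (m s : ℝ) : phi m s = |s| ^ (m - 2) * s := by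
  unfold phi; split_ifs with h <;> simp [h]

lemma phi_of_pos (m : ℝ) {s : ℝ} (hs : 0 < s) : phi m s = s ^ (m - 1) := by
  rw [phi_eq, abs_of_pos hs, ← rpow_add_one hs.ne']; congr 1; ring

lemma phi_zero (m : ℝ) : phi m 0 = 0 := by simp [phi]

lemma phi_neg (m s : ℝ) : phi m (-s) = -phi m s := by simp [phi_eq]

lemma phi_mul (m x y : ℝ) : phi m (x * y) = phi m x * phi m y := by
  simp only [phi_eq, abs_mul, mul_rpow (abs_nonneg x) (abs_nonneg y)]; ring

lemma phi_conj {p : ℝ} (hp : 1 < p) (s : ℝ) : phi (p / (p - 1)) (phi p s) = s := by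
  have key : ∀ s : ℝ, 0 < s → phi (p / (p - 1)) (phi p s) = s := fun s hs => by
    have h1 : p - 1 ≠ 0 := by linarith
    rw [phi_of_pos p hs, phi_of_pos _ (rpow_pos_of_pos hs _), ← rpow_mul hs.le]
    rw [show (p - 1) * (p / (p - 1) - 1) = 1 by field_simp; ring, rpow_one]
  rcases lt_trichotomy s 0 with h | h | h
  · have := key (-s) (by linarith)
    rw [phi_neg, phi_neg] at this; linarith
  · simp [h, phi_zero]
  · exact key s h

lemma abs_phi {m : ℝ} (hm : 1 < m) (s : ℝ) : |phi m s| = |s| ^ (m - 1) := by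
  rcases eq_or_ne s 0 with h | h
  · rw [h, phi_zero, abs_zero, zero_rpow (by linarith)]
  · rw [← phi_of_pos m (abs_pos.2 h), phi_eq, phi_eq, abs_mul, abs_abs,
      abs_of_nonneg (rpow_nonneg (abs_nonneg s) _)]

lemma abs_phi_rpow_conj {p : ℝ} (hp : 1 < p) (s : ℝ) : |phi p s| ^ (p / (p - 1)) = |s| ^ p := by
  have h1 : p - 1 ≠ 0 := by linarith
  rw [abs_phi hp, ← rpow_mul (abs_nonneg s)]; congr 1; field_simp

lemma hasStrictDerivAt_abs_rpow_phi {m : ℝ} (hm : 1 < m) (x : ℝ) :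
    HasStrictDerivAt (fun x : ℝ => |x| ^ m) (m * phi m x) x := by
  have h := ((contDiff_norm_rpow (E := ℝ) hm).contDiffAt (x := x)).hasStrictDerivAt one_ne_zero
  have h2 := hasDerivAt_abs_rpow x hm
  simp only [Real.norm_eq_abs] at h
  rw [h2.deriv] at h
  convert! h using 1
  rw [phi_eq]; ring

lemma continuous_phi {m : ℝ} (hm : 1 < m) : Continuous (phi m) := by
  have h := (contDiff_norm_rpow (E := ℝ) hm).continuous_deriv le_rfl
  have h2 : deriv (fun x : ℝ => ‖x‖ ^ m) = fun x => m * phi m x := by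
    funext x; exact (hasStrictDerivAt_abs_rpow_phi hm x).hasDerivAt.deriv
  rw [h2] at h
  have h3 : phi m = fun x => m⁻¹ * (m * phi m x) := by
    funext x; rw [inv_mul_cancel_left₀ (by linarith)]
  rw [h3]; exact h.const_mul _

lemma exists_hasStrictDerivAt_phi (m : ℝ) {x : ℝ} (hx : x ≠ 0) :
    ∃ d, HasStrictDerivAt (phi m) d x := by
  have h1 : ContDiffAt ℝ 1 (fun x : ℝ => |x| ^ (m - 2) * x) x :=
    ((contDiffAt_abs hx).rpow_const_of_ne (abs_ne_zero.2 hx)).mul contDiffAt_id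
  refine ⟨_, (h1.hasStrictDerivAt one_ne_zero).congr_of_eventuallyEq ?_⟩
  exact Eventually.of_forall fun y => (phi_eq m y).symm

lemma phi_ne_zero (m : ℝ) {x : ℝ} (hx : x ≠ 0) : phi m x ≠ 0 := by
  rw [phi_eq]; exact mul_ne_zero (rpow_pos_of_pos (abs_pos.2 hx) _).ne' hx

open Topology in
/-- Local forward uniqueness for `x' = a(y)` along a conserved quantity `A(y) + B(x)` with
`A'(y₀) ≠ 0`. -/
lemma eventually_eq_of_conserved {x₁ x₂ y₁ y₂ A B a : ℝ → ℝ} {t₀ A' B' a' : ℝ}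
    (hA : HasStrictDerivAt A A' (y₁ t₀)) (hA' : A' ≠ 0)
    (hB : HasStrictDerivAt B B' (x₁ t₀)) (ha : HasStrictDerivAt a a' (y₁ t₀))
    (hx₁ : ∀ᶠ t in 𝓝[≥] t₀, HasDerivWithinAt x₁ (a (y₁ t)) (Ici t) t)
    (hx₂ : ∀ᶠ t in 𝓝[≥] t₀, HasDerivWithinAt x₂ (a (y₂ t)) (Ici t) t)
    (hcx₁ : ∀ᶠ t in 𝓝[≥] t₀, ContinuousWithinAt x₁ (Ici t₀) t)
    (hcx₂ : ∀ᶠ t in 𝓝[≥] t₀, ContinuousWithinAt x₂ (Ici t₀) t)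
    (hy₁ : ContinuousWithinAt y₁ (Ici t₀) t₀) (hy₂ : ContinuousWithinAt y₂ (Ici t₀) t₀)
    (hx : x₁ t₀ = x₂ t₀) (hy : y₁ t₀ = y₂ t₀)
    (hE : ∀ᶠ t in 𝓝[≥] t₀, A (y₁ t) + B (x₁ t) = A (y₂ t) + B (x₂ t)) :
    ∀ᶠ t in 𝓝[≥] t₀, x₁ t = x₂ t ∧ y₁ t = y₂ t := by
  have hy₂' : Tendsto y₂ (𝓝[≥] t₀) (𝓝 (y₁ t₀)) := by rw [hy]; exact hy₂
  have hty : Tendsto (fun t => (y₁ t, y₂ t)) (𝓝[≥] t₀) (𝓝 (y₁ t₀, y₁ t₀)) :=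
    hy₁.tendsto.prodMk_nhds hy₂'
  have h₁ : ContinuousWithinAt x₁ (Ici t₀) t₀ := hcx₁.self_of_nhdsWithin self_mem_Ici
  have h₂ : ContinuousWithinAt x₂ (Ici t₀) t₀ := hcx₂.self_of_nhdsWithin self_mem_Ici
  have h₂' : Tendsto x₂ (𝓝[≥] t₀) (𝓝 (x₁ t₀)) := by rw [hx]; exact h₂
  have htx : Tendsto (fun t => (x₁ t, x₂ t)) (𝓝[≥] t₀) (𝓝 (x₁ t₀, x₁ t₀)) :=
    h₁.tendsto.prodMk_nhds h₂'
  have e1 : (fun t => y₁ t - y₂ t) =O[𝓝[≥] t₀] fun t => A (y₁ t) - A (y₂ t) :=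
    (HasDerivAtFilter.isTheta_sub hA hA').isBigO_symm.comp_tendsto
      hty
  have e2 : (fun t => A (y₁ t) - A (y₂ t)) =O[𝓝[≥] t₀] fun t => B (x₁ t) - B (x₂ t) := by
    refine Asymptotics.IsBigO.of_bound 1 ?_
    filter_upwards [hE] with t ht
    rw [show A (y₁ t) - A (y₂ t) = -(B (x₁ t) - B (x₂ t)) by linarith, norm_neg, one_mul]
  have e3 : (fun t => B (x₁ t) - B (x₂ t)) =O[𝓝[≥] t₀] fun t => x₁ t - x₂ t :=
    hB.hasStrictFDerivAt.isBigO_sub.comp_tendsto htx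
  have e4 : (fun t => a (y₁ t) - a (y₂ t)) =O[𝓝[≥] t₀] fun t => y₁ t - y₂ t :=
    ha.hasStrictFDerivAt.isBigO_sub.comp_tendsto hty
  have e5 := (e1.trans e2).trans e3
  obtain ⟨C, hC⟩ := (e4.trans e5).bound
  obtain ⟨D, hD⟩ := e5.bound
  have hall := (((hx₁.and hx₂).and (hcx₁.and hcx₂)).and hC)
  obtain ⟨b, hb, hsub⟩ := (mem_nhdsGE_iff_exists_Icc_subset (a := t₀)).1 hall
  have key : ∀ t ∈ Icc t₀ b, x₁ t - x₂ t = 0 := by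
    refine eq_zero_of_abs_deriv_le_mul_abs_self_of_eq_zero_right (K := C)
      (f' := fun t => a (y₁ t) - a (y₂ t)) ?_ ?_ (by simp [hx]) ?_
    · intro t ht
      exact ((hsub ht).1.2.1.sub (hsub ht).1.2.2).mono Icc_subset_Ici_self
    · intro t ht
      exact (hsub (Ico_subset_Icc_self ht)).1.1.1.sub (hsub (Ico_subset_Icc_self ht)).1.1.2
    · intro t ht
      exact (hsub (Ico_subset_Icc_self ht)).2
  filter_upwards [hD, Icc_mem_nhdsGE hb] with t ht htb
  have h0 := key t htb
  rw [h0, norm_zero, mul_zero] at ht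
  exact ⟨by linarith, by have := norm_le_zero_iff.1 ht; linarith⟩

/-- `u` is a classical solution of the boundary value problem with derivative `v`. -/
def IsSolPair (p q T lam : ℝ) (u v : ℝ → ℝ) : Prop :=
  (∀ t ∈ Icc 0 T, HasDerivWithinAt u (v t) (Icc 0 T) t) ∧
    ContinuousOn v (Icc 0 T) ∧
    ∀ t ∈ Ioo 0 T, HasDerivWithinAt (fun s => phi p (v s))
      (-(lam * phi q (u t) * (1 - |u t| ^ q))) (Ioo 0 T) t

/-- The potential energy. -/
noncomputable def potential (q lam x : ℝ) : ℝ := lam / q * (|x| ^ q - (|x| ^ q) ^ 2 / 2)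

/-- The total energy. -/
noncomputable def energy (p q lam x y : ℝ) : ℝ := (p - 1) / p * |y| ^ p + potential q lam x

lemma hasStrictDerivAt_potential {q : ℝ} (hq : 1 < q) (lam x : ℝ) :
    HasStrictDerivAt (potential q lam) (lam * phi q x * (1 - |x| ^ q)) x := by
  have h := hasStrictDerivAt_abs_rpow_phi hq x
  have h2 := ((h.sub ((h.fun_pow 2).div_const 2)).const_mul (lam / q))
  convert! h2 using 1
  have : q ≠ 0 := by linarith
  field_simp
  push_cast; ring

lemma hasStrictDerivAt_kinetic {p : ℝ} (hp : 1 < p) (y : ℝ) :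
    HasStrictDerivAt (fun y : ℝ => (p - 1) / p * |y| ^ (p / (p - 1))) (phi (p / (p - 1)) y) y := by
  have h1 : p - 1 ≠ 0 := by linarith
  have h2 : 1 < p / (p - 1) := by rw [lt_div_iff₀ (by linarith)]; linarith
  have h := (hasStrictDerivAt_abs_rpow_phi h2 y).const_mul ((p - 1) / p)
  convert! h using 1
  have : p ≠ 0 := by linarith
  field_simp

lemma energy_eq {p : ℝ} (hp : 1 < p) (q lam x y : ℝ) :
    energy p q lam x y = (p - 1) / p * |phi p y| ^ (p / (p - 1)) + potential q lam x := by
  rw [energy, abs_phi_rpow_conj hp]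

lemma IsSolPair.continuousOn {p q T lam : ℝ} {u v : ℝ → ℝ} (h : IsSolPair p q T lam u v) :
    ContinuousOn u (Icc 0 T) := fun t ht => (h.1 t ht).continuousWithinAt

lemma IsSolPair.continuousOn_phi {p q T lam : ℝ} (hp : 1 < p) {u v : ℝ → ℝ}
    (h : IsSolPair p q T lam u v) : ContinuousOn (fun t => phi p (v t)) (Icc 0 T) :=
  (continuous_phi hp).comp_continuousOn h.2.1

lemma IsSolPair.energy_const {p q T lam : ℝ} (hp : 1 < p) (hq : 1 < q) {u v : ℝ → ℝ}
    (h : IsSolPair p q T lam u v) {s t : ℝ} (hs : s ∈ Icc 0 T) (ht : t ∈ Icc 0 T) :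
    energy p q lam (u s) (v s) = energy p q lam (u t) (v t) := by
  have h1 : p - 1 ≠ 0 := by linarith
  have h2 : 1 < p / (p - 1) := by rw [lt_div_iff₀ (by linarith)]; linarith
  set f : ℝ → ℝ := fun t => (p - 1) / p * |phi p (v t)| ^ (p / (p - 1)) + potential q lam (u t)
    with hf
  have hfe : ∀ t, energy p q lam (u t) (v t) = f t := fun t => energy_eq hp _ _ _ _
  have hc : ContinuousOn f (Icc 0 T) := by
    refine ContinuousOn.add ?_ ?_
    · exact (continuous_iff_continuousAt.2 fun y =>
        (hasStrictDerivAt_kinetic hp y).hasDerivAt.continuousAt).comp_continuousOn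
          (h.continuousOn_phi hp)
    · exact (continuous_iff_continuousAt.2 fun y =>
        (hasStrictDerivAt_potential hq lam y).hasDerivAt.continuousAt).comp_continuousOn
          h.continuousOn
  have hd : ∀ t ∈ interior (Icc 0 T), HasDerivAt f 0 t := by
    intro t ht
    rw [interior_Icc] at ht
    have d1 := (h.2.2 t ht).hasDerivAt (Ioo_mem_nhds ht.1 ht.2)
    have d2 := (h.1 t (Ioo_subset_Icc_self ht)).hasDerivAt (Icc_mem_nhds ht.1 ht.2)
    have d3 := (hasStrictDerivAt_kinetic hp (phi p (v t))).hasDerivAt.comp t d1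
    have d4 := (hasStrictDerivAt_potential hq lam (u t)).hasDerivAt.comp t d2
    convert! d3.add d4 using 1
    rw [phi_conj hp]; ring
  have hm : MonotoneOn f (Icc 0 T) := monotoneOn_of_deriv_nonneg (convex_Icc 0 T) hc
    (fun t ht => (hd t ht).differentiableAt.differentiableWithinAt) fun t ht => (hd t ht).deriv.ge
  have ha : AntitoneOn f (Icc 0 T) := antitoneOn_of_deriv_nonpos (convex_Icc 0 T) hc
    (fun t ht => (hd t ht).differentiableAt.differentiableWithinAt) fun t ht => (hd t ht).deriv.le
  rw [hfe, hfe]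
  rcases le_total s t with hst | hst
  · exact le_antisymm (hm hs ht hst) (ha hs ht hst)
  · exact le_antisymm (ha ht hs hst) (hm ht hs hst)

open Topology in
/-- Two solutions with the same initial data agree if the first one never passes through an
equilibrium. -/
lemma IsSolPair.eqOn {p q T lam : ℝ} (hp : 1 < p) (hq : 1 < q) (hlam : lam ≠ 0)
    {u₁ v₁ u₂ v₂ : ℝ → ℝ} (h₁ : IsSolPair p q T lam u₁ v₁) (h₂ : IsSolPair p q T lam u₂ v₂)
    (hu : u₁ 0 = u₂ 0) (hv : v₁ 0 = v₂ 0) (hv0 : v₁ 0 ≠ 0)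
    (hne : ∀ t ∈ Icc 0 T, v₁ t = 0 → u₁ t ≠ 0 ∧ |u₁ t| ^ q ≠ 1) :
    ∀ t ∈ Icc 0 T, u₁ t = u₂ t := by
  rcases lt_or_ge T 0 with hT | hT
  · simp [Icc_eq_empty hT.not_ge]
  have hinj : Function.Injective (phi p) := fun x y hxy => by
    rw [← phi_conj hp x, ← phi_conj hp y, hxy]
  have hcl : IsClosed ({t | (u₁ t, v₁ t) = (u₂ t, v₂ t)} ∩ Icc 0 T) := by
    have hc : ContinuousOn (fun t => (u₁ t - u₂ t, v₁ t - v₂ t)) (Icc 0 T) :=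
      (h₁.continuousOn.sub h₂.continuousOn).prodMk (h₁.2.1.sub h₂.2.1)
    have := hc.preimage_isClosed_of_isClosed isClosed_Icc (isClosed_singleton (x := ((0 : ℝ), (0 : ℝ))))
    convert! this using 1
    ext t
    simp [sub_eq_zero, and_comm]
  have hE : ∀ t ∈ Icc 0 T, energy p q lam (u₁ t) (v₁ t) = energy p q lam (u₂ t) (v₂ t) := by
    intro t ht
    rw [h₁.energy_const hp hq ht (left_mem_Icc.2 hT), h₂.energy_const hp hq ht (left_mem_Icc.2 hT),
      hu, hv]
  have hsub := hcl.Icc_subset_of_forall_mem_nhdsWithin (by simp [hu, hv]) ?_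
  · intro t ht
    exact (Prod.ext_iff.1 (hsub ht)).1
  rintro t₀ ⟨heq, ht₀⟩
  simp only [mem_ofPred_eq, Prod.mk.injEq] at heq
  have hmem : ∀ᶠ t in 𝓝[≥] t₀, t ∈ Ico t₀ T := Ico_mem_nhdsGE ht₀.2
  have hIcc : ∀ {t}, t ∈ Ico t₀ T → t ∈ Icc 0 T := fun ht => ⟨ht₀.1.trans ht.1, ht.2.le⟩
  have hcw : ∀ {f : ℝ → ℝ}, ContinuousOn f (Icc 0 T) → ∀ t ∈ Ico t₀ T,
      ContinuousWithinAt f (Ici t₀) t := by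
    intro f hf t ht
    have h3 : ContinuousWithinAt f (Icc t₀ T) t :=
      (hf t (hIcc ht)).mono (Icc_subset_Icc_left ht₀.1)
    refine h3.mono_of_mem_nhdsWithin ?_
    filter_upwards [self_mem_nhdsWithin, mem_nhdsWithin_of_mem_nhds (Iic_mem_nhds ht.2)] with s a b
    exact ⟨a, b⟩
  have hdw : ∀ {f : ℝ → ℝ} {f' t : ℝ}, t ∈ Ico t₀ T → HasDerivWithinAt f f' (Icc 0 T) t →
      HasDerivWithinAt f f' (Ici t) t := by
    intro f f' t ht hf
    refine hf.mono_of_mem_nhdsWithin ?_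
    filter_upwards [Icc_mem_nhdsGE ht.2] with s hs
    exact ⟨(hIcc ht).1.trans hs.1, hs.2⟩
  have ht₀' : t₀ ∈ Ico t₀ T := left_mem_Ico.2 ht₀.2
  have hnhds : 𝓝[>] t₀ ≤ 𝓝[≥] t₀ := nhdsWithin_mono _ Ioi_subset_Ici_self
  by_cases hvt : v₁ t₀ = 0
  · have hpos : 0 < t₀ := lt_of_le_of_ne ht₀.1 fun h => hv0 (by rwa [← h] at hvt)
    obtain ⟨hu0, hu1⟩ := hne t₀ (hIcc ht₀') hvt
    obtain ⟨d, hd⟩ := exists_hasStrictDerivAt_phi q hu0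
    have hA := hasStrictDerivAt_potential hq lam (u₁ t₀)
    have hB := hasStrictDerivAt_kinetic hp (phi p (v₁ t₀))
    have ha := (((hd.const_mul lam).mul
      ((hasStrictDerivAt_abs_rpow_phi hq (u₁ t₀)).const_sub 1)).fun_neg)
    have hioo : ∀ {t}, t ∈ Ico t₀ T → t ∈ Ioo 0 T := fun ht => ⟨hpos.trans_le ht.1, ht.2⟩
    have hw : ∀ {u v : ℝ → ℝ}, IsSolPair p q T lam u v → ∀ᶠ t in 𝓝[≥] t₀,
        HasDerivWithinAt (fun s => phi p (v s)) (-(lam * phi q (u t) * (1 - |u t| ^ q)))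
          (Ici t) t := by
      intro u v h
      filter_upwards [hmem] with t ht
      exact ((h.2.2 t (hioo ht)).hasDerivAt (Ioo_mem_nhds (hioo ht).1 (hioo ht).2)).hasDerivWithinAt
    have := eventually_eq_of_conserved (x₁ := fun t => phi p (v₁ t)) (x₂ := fun t => phi p (v₂ t))
      (y₁ := u₁) (y₂ := u₂) hA
      (mul_ne_zero (mul_ne_zero hlam (phi_ne_zero q hu0)) (sub_ne_zero.2 (Ne.symm hu1))) hB ha
      (hw h₁) (hw h₂)
      (hmem.mono fun t ht => hcw (h₁.continuousOn_phi hp) t ht)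
      (hmem.mono fun t ht => hcw (h₂.continuousOn_phi hp) t ht)
      (hcw h₁.continuousOn t₀ ht₀') (hcw h₂.continuousOn t₀ ht₀')
      (by simp only [heq.2]) heq.1
      (hmem.mono fun t ht => by
        have := hE t (hIcc ht)
        rw [energy_eq hp, energy_eq hp] at this
        linarith)
    filter_upwards [this.filter_mono hnhds] with t ht
    exact Prod.ext ht.2 (hinj ht.1)
  · have hw0 : phi p (v₁ t₀) ≠ 0 := phi_ne_zero p hvt
    obtain ⟨d, hd⟩ := exists_hasStrictDerivAt_phi (p / (p - 1)) hw0
    have hA := hasStrictDerivAt_kinetic hp (phi p (v₁ t₀))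
    have hB := hasStrictDerivAt_potential hq lam (u₁ t₀)
    have hw : ∀ {u v : ℝ → ℝ}, IsSolPair p q T lam u v → ∀ᶠ t in 𝓝[≥] t₀,
        HasDerivWithinAt u (phi (p / (p - 1)) (phi p (v t))) (Ici t) t := by
      intro u v h
      filter_upwards [hmem] with t ht
      rw [phi_conj hp]
      exact hdw ht (h.1 t (hIcc ht))
    have := eventually_eq_of_conserved (x₁ := u₁) (x₂ := u₂)
      (y₁ := fun t => phi p (v₁ t)) (y₂ := fun t => phi p (v₂ t)) hA
      (phi_ne_zero _ hw0) hB hd (hw h₁) (hw h₂)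
      (hmem.mono fun t ht => hcw h₁.continuousOn t ht)
      (hmem.mono fun t ht => hcw h₂.continuousOn t ht)
      (hcw (h₁.continuousOn_phi hp) t₀ ht₀') (hcw (h₂.continuousOn_phi hp) t₀ ht₀')
      heq.1 (by simp only [heq.2])
      (hmem.mono fun t ht => by
        have := hE t (hIcc ht)
        rwa [energy_eq hp, energy_eq hp] at this)
    filter_upwards [this.filter_mono hnhds] with t ht
    exact Prod.ext ht.1 (hinj ht.2)

/-- The even extension `(1 - |x|^q)(1 - k^q|x|^q)` of the radicand of `arcsnPQ`. -/
noncomputable def radicand (q k x : ℝ) : ℝ := (1 - |x| ^ q) * (1 - k ^ q * |x| ^ q)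

/-- The odd extension of `arcsnPQ p q k` to `[-1, 1]`. -/
noncomputable def arcsnOdd (p q k σ : ℝ) : ℝ := ∫ s in (0:ℝ)..σ, radicand q k s ^ (-(1 / p))

lemma radicand_neg (q k x : ℝ) : radicand q k (-x) = radicand q k x := by simp [radicand]

lemma radicand_pos {q k x : ℝ} (hq : 1 < q) (hk : k ∈ Ioo (0 : ℝ) 1) (hx : |x| < 1) :
    0 < radicand q k x := by
  have h1 : |x| ^ q < 1 := rpow_lt_one (abs_nonneg x) hx (by linarith)
  have h2 : k ^ q < 1 := rpow_lt_one hk.1.le hk.2 (by linarith)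
  have h3 : 0 ≤ k ^ q := rpow_nonneg hk.1.le _
  have h4 : 0 ≤ |x| ^ q := rpow_nonneg (abs_nonneg x) _
  exact mul_pos (by linarith) (by nlinarith)

lemma hasDerivAt_radicand {q : ℝ} (hq : 1 < q) (k x : ℝ) :
    HasDerivAt (radicand q k) (-(q * phi q x * (1 + k ^ q - 2 * k ^ q * |x| ^ q))) x := by
  have h := (hasStrictDerivAt_abs_rpow_phi hq x).hasDerivAt
  have := (h.const_sub 1).mul ((h.const_mul (k ^ q)).const_sub 1)
  convert! this using 1
  ring

lemma continuous_radicand {q : ℝ} (hq : 1 < q) (k : ℝ) : Continuous (radicand q k) :=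
  continuous_iff_continuousAt.2 fun x => (hasDerivAt_radicand hq k x).continuousAt

lemma intervalIntegrable_radicand {p q k : ℝ} (hp : 1 < p) (hq : 1 < q) (hk : k ∈ Ioo (0 : ℝ) 1) :
    IntervalIntegrable (fun s => radicand q k s ^ (-(1 / p))) volume (-1) 1 := by
  have hp' : (1 : ℝ) / p < 1 := by rw [div_lt_one (by linarith)]; exact hp
  have hp0 : 0 < 1 / p := by positivity
  have hm : Measurable fun s => radicand q k s ^ (-(1 / p)) :=
    (continuous_radicand hq k).measurable.pow_const _
  have h01 : IntervalIntegrable (fun s => radicand q k s ^ (-(1 / p))) volume 0 1 := by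
    have hb : IntervalIntegrable (fun s : ℝ => (1 - s) ^ (-(1 / p))) volume 0 1 := by
      have := (intervalIntegral.intervalIntegrable_rpow' (a := 1) (b := 0) (r := -(1 / p))
        (by linarith)).comp_sub_left 1
      simpa using this
    refine (hb.const_mul ((1 - k ^ q) ^ (-(1 / p)))).mono_fun' hm.aestronglyMeasurable ?_
    filter_upwards [ae_restrict_mem measurableSet_uIoc,
      Measure.ae_ne (volume.restrict (uIoc (0 : ℝ) 1)) 1] with s hs hs1
    rw [uIoc_of_le zero_le_one] at hs
    have hs2 : s < 1 := lt_of_le_of_ne hs.2 hs1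
    have hk1 : k ^ q < 1 := rpow_lt_one hk.1.le hk.2 (by linarith)
    have hk0 : 0 ≤ k ^ q := rpow_nonneg hk.1.le _
    have hsq : s ^ q ≤ s := rpow_le_self_of_le_one hs.1.le hs.2 hq.le
    have hsq0 : 0 ≤ s ^ q := rpow_nonneg hs.1.le _
    have habs : |s| = s := abs_of_pos hs.1
    have hpos : 0 < radicand q k s := radicand_pos hq hk (by rwa [habs])
    rw [norm_of_nonneg (rpow_nonneg hpos.le _), ← mul_rpow (by linarith) (by linarith)]
    refine rpow_le_rpow_of_nonpos (mul_pos (by linarith) (by linarith)) ?_ (by linarith)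
    rw [radicand, habs, mul_comm]
    refine mul_le_mul (by linarith) (by nlinarith) (by linarith) (by linarith)
  have h10 : IntervalIntegrable (fun s => radicand q k s ^ (-(1 / p))) volume (-1) 0 := by
    have := (h01.comp_sub_left 0).symm
    simpa [radicand_neg] using this
  exact h10.trans h01

lemma arcsnOdd_neg (p q k σ : ℝ) : arcsnOdd p q k (-σ) = -arcsnOdd p q k σ := by
  have h := intervalIntegral.integral_comp_neg (a := 0) (b := σ)
    fun s => radicand q k s ^ (-(1 / p))
  simp only [radicand_neg, neg_zero] at h
  rw [arcsnOdd, arcsnOdd, h, intervalIntegral.integral_symm]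

lemma arcsnOdd_of_nonneg (p q k : ℝ) {σ : ℝ} (hσ : 0 ≤ σ) :
    arcsnOdd p q k σ = arcsnPQ p q k σ := by
  refine intervalIntegral.integral_congr fun s hs => ?_
  rw [uIcc_of_le hσ] at hs
  simp only [radicand, abs_of_nonneg hs.1]

lemma hasDerivAt_arcsnOdd {p q k σ : ℝ} (hp : 1 < p) (hq : 1 < q) (hk : k ∈ Ioo (0 : ℝ) 1)
    (hσ : σ ∈ Ioo (-1 : ℝ) 1) :
    HasDerivAt (arcsnOdd p q k) (radicand q k σ ^ (-(1 / p))) σ := by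
  have hpos : 0 < radicand q k σ := radicand_pos hq hk (abs_lt.2 hσ)
  refine intervalIntegral.integral_hasDerivAt_right
    ((intervalIntegrable_radicand hp hq hk).mono_set ?_) ?_ ?_
  · rw [uIcc_of_le (by norm_num : (-1 : ℝ) ≤ 1)]
    exact uIcc_subset_Icc (by constructor <;> norm_num) (Ioo_subset_Icc_self hσ)
  · exact ((continuous_radicand hq k).measurable.pow_const _).stronglyMeasurable.stronglyMeasurableAtFilter
  · exact (continuous_radicand hq k).continuousAt.rpow_const (Or.inl hpos.ne')

lemma continuousOn_arcsnOdd {p q k : ℝ} (hp : 1 < p) (hq : 1 < q) (hk : k ∈ Ioo (0 : ℝ) 1) :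
    ContinuousOn (arcsnOdd p q k) (Icc (-1) 1) := by
  have := intervalIntegral.continuousOn_primitive_interval' (intervalIntegrable_radicand hp hq hk)
    (a := 0) (by rw [uIcc_of_le] <;> norm_num)
  rwa [uIcc_of_le (by norm_num)] at this

lemma strictMonoOn_arcsnOdd {p q k : ℝ} (hp : 1 < p) (hq : 1 < q) (hk : k ∈ Ioo (0 : ℝ) 1) :
    StrictMonoOn (arcsnOdd p q k) (Icc (-1) 1) := by
  refine strictMonoOn_of_deriv_pos (convex_Icc _ _) (continuousOn_arcsnOdd hp hq hk) fun σ hσ => ?_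
  rw [interior_Icc] at hσ
  rw [(hasDerivAt_arcsnOdd hp hq hk hσ).deriv]
  exact rpow_pos_of_pos (radicand_pos hq hk (abs_lt.2 hσ)) _

lemma arcsnOdd_zero (p q k : ℝ) : arcsnOdd p q k 0 = 0 := by simp [arcsnOdd]

lemma arcsnOdd_one (p q k : ℝ) : arcsnOdd p q k 1 = Kpq p q k :=
  arcsnOdd_of_nonneg p q k zero_le_one

lemma Kpq_pos {p q k : ℝ} (hp : 1 < p) (hq : 1 < q) (hk : k ∈ Ioo (0 : ℝ) 1) : 0 < Kpq p q k := by
  rw [← arcsnOdd_one, ← arcsnOdd_zero p q k]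
  exact strictMonoOn_arcsnOdd hp hq hk (by norm_num) (by norm_num) zero_lt_one

/-- `S` is the generalized Jacobian sine function with modulus `k`. -/
structure IsSn (p q k : ℝ) (S : ℝ → ℝ) : Prop where
  inv : ∀ σ ∈ Icc (0 : ℝ) 1, S (arcsnPQ p q k σ) = σ
  refl : ∀ t ∈ Icc (Kpq p q k) (2 * Kpq p q k), S t = S (2 * Kpq p q k - t)
  odd : ∀ t : ℝ, S (-t) = -S t
  per : ∀ t : ℝ, S (t + 4 * Kpq p q k) = S t

namespace IsSn

variable {p q k : ℝ} {S : ℝ → ℝ}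

lemma inv_odd (h : IsSn p q k S) {σ : ℝ} (hσ : σ ∈ Icc (-1 : ℝ) 1) :
    S (arcsnOdd p q k σ) = σ := by
  rcases le_total 0 σ with h0 | h0
  · rw [arcsnOdd_of_nonneg _ _ _ h0]; exact h.inv σ ⟨h0, hσ.2⟩
  · have h1 : 0 ≤ -σ := by linarith
    have := h.inv (-σ) ⟨h1, by linarith [hσ.1]⟩
    rw [← arcsnOdd_of_nonneg _ _ _ h1, arcsnOdd_neg, h.odd] at this
    linarith

lemma exists_arcsnOdd_eq (hp : 1 < p) (hq : 1 < q) (hk : k ∈ Ioo (0 : ℝ) 1) {t : ℝ}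
    (ht : t ∈ Icc (-Kpq p q k) (Kpq p q k)) : ∃ σ ∈ Icc (-1 : ℝ) 1, arcsnOdd p q k σ = t := by
  have := intermediate_value_Icc (by norm_num : (-1 : ℝ) ≤ 1) (continuousOn_arcsnOdd hp hq hk)
  rw [arcsnOdd_neg, arcsnOdd_one] at this
  exact this ht

lemma mem_Icc (h : IsSn p q k S) (hp : 1 < p) (hq : 1 < q) (hk : k ∈ Ioo (0 : ℝ) 1) {t : ℝ}
    (ht : t ∈ Icc (-Kpq p q k) (Kpq p q k)) :
    S t ∈ Icc (-1 : ℝ) 1 ∧ arcsnOdd p q k (S t) = t := by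
  obtain ⟨σ, hσ, rfl⟩ := exists_arcsnOdd_eq hp hq hk ht
  rw [h.inv_odd hσ]; exact ⟨hσ, rfl⟩

lemma strictMonoOn (h : IsSn p q k S) (hp : 1 < p) (hq : 1 < q) (hk : k ∈ Ioo (0 : ℝ) 1) :
    StrictMonoOn S (Icc (-Kpq p q k) (Kpq p q k)) := by
  intro s hs t ht hst
  obtain ⟨h1, h2⟩ := h.mem_Icc hp hq hk hs
  obtain ⟨h3, h4⟩ := h.mem_Icc hp hq hk ht
  rwa [← (strictMonoOn_arcsnOdd hp hq hk).lt_iff_lt h1 h3, h2, h4]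

lemma apply_K (h : IsSn p q k S) : S (Kpq p q k) = 1 := h.inv 1 (by norm_num)

lemma apply_zero (h : IsSn p q k S) : S 0 = 0 := by
  have := h.odd 0
  rw [neg_zero] at this; linarith

lemma mem_Ioo (h : IsSn p q k S) (hp : 1 < p) (hq : 1 < q) (hk : k ∈ Ioo (0 : ℝ) 1) {t : ℝ}
    (ht : t ∈ Ioo (-Kpq p q k) (Kpq p q k)) : S t ∈ Ioo (-1 : ℝ) 1 := by
  have hK := Kpq_pos hp hq hk
  have h1 := h.strictMonoOn hp hq hk (left_mem_Icc.2 (by linarith)) (Ioo_subset_Icc_self ht) ht.1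
  have h2 := h.strictMonoOn hp hq hk (Ioo_subset_Icc_self ht) (right_mem_Icc.2 (by linarith)) ht.2
  rw [h.odd, h.apply_K] at h1
  rw [h.apply_K] at h2
  exact ⟨h1, h2⟩

lemma image_Icc (h : IsSn p q k S) (hp : 1 < p) (hq : 1 < q) (hk : k ∈ Ioo (0 : ℝ) 1) :
    Icc (-1 : ℝ) 1 ⊆ S '' Icc (-Kpq p q k) (Kpq p q k) := by
  intro σ hσ
  refine ⟨arcsnOdd p q k σ, ?_, h.inv_odd hσ⟩
  have hm := (strictMonoOn_arcsnOdd hp hq hk).monotoneOn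
  have h1 := hm (left_mem_Icc.2 (by norm_num)) hσ hσ.1
  have h2 := hm hσ (right_mem_Icc.2 (by norm_num)) hσ.2
  rw [arcsnOdd_neg, arcsnOdd_one] at h1
  rw [arcsnOdd_one] at h2
  exact ⟨h1, h2⟩

lemma continuousAt (h : IsSn p q k S) (hp : 1 < p) (hq : 1 < q) (hk : k ∈ Ioo (0 : ℝ) 1) {t : ℝ}
    (ht : t ∈ Ioo (-Kpq p q k) (Kpq p q k)) : ContinuousAt S t := by
  have := h.mem_Ioo hp hq hk ht
  exact (h.strictMonoOn hp hq hk).continuousAt_of_image_mem_nhds (Icc_mem_nhds ht.1 ht.2)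
    (mem_of_superset (Icc_mem_nhds this.1 this.2) (h.image_Icc hp hq hk))

lemma continuousWithinAt_K (h : IsSn p q k S) (hp : 1 < p) (hq : 1 < q) (hk : k ∈ Ioo (0 : ℝ) 1) :
    ContinuousWithinAt S (Iic (Kpq p q k)) (Kpq p q k) := by
  have hK := Kpq_pos hp hq hk
  refine (h.strictMonoOn hp hq hk).continuousWithinAt_left_of_image_mem_nhdsWithin
    (Icc_mem_nhdsLE (by linarith)) (mem_of_superset ?_ (h.image_Icc hp hq hk))
  rw [h.apply_K]
  exact Icc_mem_nhdsLE (by norm_num)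

lemma hasDerivAt_of_mem_Ioo (h : IsSn p q k S) (hp : 1 < p) (hq : 1 < q)
    (hk : k ∈ Ioo (0 : ℝ) 1) {t : ℝ} (ht : t ∈ Ioo (-Kpq p q k) (Kpq p q k)) :
    HasDerivAt S (radicand q k (S t) ^ (1 / p)) t := by
  have hS := h.mem_Ioo hp hq hk ht
  have hpos : 0 < radicand q k (S t) := radicand_pos hq hk (abs_lt.2 hS)
  have := HasDerivAt.of_local_left_inverse (h.continuousAt hp hq hk ht)
    (hasDerivAt_arcsnOdd hp hq hk hS) (rpow_pos_of_pos hpos _).ne' ?_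
  · rwa [rpow_neg hpos.le, inv_inv] at this
  · filter_upwards [Icc_mem_nhds ht.1 ht.2] with s hs
    exact (h.mem_Icc hp hq hk hs).2

/-- The differential equation satisfied by the generalized sine function at a point. -/
def OdeAt (p q k : ℝ) (S : ℝ → ℝ) (t : ℝ) : Prop :=
  HasDerivAt S (deriv S t) t ∧ HasDerivAt (fun s => phi p (deriv S s))
    (-((p - 1) / p * q * phi q (S t) * (1 + k ^ q - 2 * k ^ q * |S t| ^ q))) t

lemma odeAt_of_mem_Ioo (h : IsSn p q k S) (hp : 1 < p) (hq : 1 < q)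
    (hk : k ∈ Ioo (0 : ℝ) 1) {t : ℝ} (ht : t ∈ Ioo (-Kpq p q k) (Kpq p q k)) :
    OdeAt p q k S t := by
  refine ⟨(h.hasDerivAt_of_mem_Ioo hp hq hk ht).differentiableAt.hasDerivAt, ?_⟩
  have hS := h.mem_Ioo hp hq hk ht
  have hpos : 0 < radicand q k (S t) := radicand_pos hq hk (abs_lt.2 hS)
  have hd := ((hasDerivAt_radicand hq k (S t)).comp t
    (h.hasDerivAt_of_mem_Ioo hp hq hk ht)).rpow_const (p := (p - 1) / p) (Or.inl hpos.ne')
  have he : (fun s => phi p (deriv S s)) =ᶠ[nhds t]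
      fun s => (radicand q k ∘ S) s ^ ((p - 1) / p) := by
    filter_upwards [Ioo_mem_nhds ht.1 ht.2] with s hs
    have hpos : 0 < radicand q k (S s) := radicand_pos hq hk (abs_lt.2 (h.mem_Ioo hp hq hk hs))
    rw [(h.hasDerivAt_of_mem_Ioo hp hq hk hs).deriv, phi_of_pos _ (rpow_pos_of_pos hpos _),
      ← rpow_mul hpos.le]
    simp only [Function.comp]; congr 1; ring
  refine (hd.congr_of_eventuallyEq he).congr_deriv ?_
  have hp0 : p ≠ 0 := by linarith
  have e1 : radicand q k (S t) ^ (1 / p) * radicand q k (S t) ^ ((p - 1) / p - 1) = 1 := by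
    rw [← rpow_add hpos, show 1 / p + ((p - 1) / p - 1) = 0 by field_simp; ring, rpow_zero]
  simp only [Function.comp]
  linear_combination (-(q * phi q (S t) * (1 + k ^ q - 2 * k ^ q * |S t| ^ q)) * ((p - 1) / p)) * e1

open Topology in
lemma _root_.hasDerivAt_of_eventually_hasDerivAt_of_tendsto {f g : ℝ → ℝ} {x e : ℝ}
    (hf : ContinuousAt f x) (hd : ∀ᶠ y in 𝓝[≠] x, HasDerivAt f (g y) y)
    (hg : Tendsto g (𝓝[≠] x) (𝓝 e)) : HasDerivAt f e x := by
  have hlim : Tendsto (fun y => deriv f y) (𝓝[≠] x) (𝓝 e) :=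
    hg.congr' (hd.mono fun y hy => hy.deriv.symm)
  have hdiff : DifferentiableOn ℝ f {y | HasDerivAt f (g y) y} := fun y hy =>
    HasDerivAt.differentiableAt (f' := g y) hy |>.differentiableWithinAt
  have hgt : 𝓝[>] x ≤ 𝓝[≠] x := nhdsWithin_mono _ fun y hy => ne_of_gt hy
  have hlt : 𝓝[<] x ≤ 𝓝[≠] x := nhdsWithin_mono _ fun y hy => ne_of_lt hy
  have h1 := hasDerivWithinAt_Ici_of_tendsto_deriv hdiff hf.continuousWithinAt (hgt hd)
    (hlim.mono_left hgt)
  have h2 := hasDerivWithinAt_Iic_of_tendsto_deriv hdiff hf.continuousWithinAt (hlt hd)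
    (hlim.mono_left hlt)
  simpa using h1.union h2

lemma reflect (h : IsSn p q k S) (hK : 0 < Kpq p q k) (t : ℝ) :
    S (2 * Kpq p q k - t) = S t := by
  have h02 : ∀ t ∈ Icc 0 (2 * Kpq p q k), S (2 * Kpq p q k - t) = S t := by
    intro t ht
    rcases le_total (Kpq p q k) t with h1 | h1
    · exact (h.refl t ⟨h1, ht.2⟩).symm
    · have := h.refl (2 * Kpq p q k - t) ⟨by linarith, by linarith [ht.1]⟩
      rwa [sub_sub_cancel] at this
  have h20 : ∀ t ∈ Icc (-(2 * Kpq p q k)) 0, S (2 * Kpq p q k - t) = S t := by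
    intro t ht
    have h1 := h02 (t + 2 * Kpq p q k) ⟨by linarith [ht.1], by linarith [ht.2]⟩
    have h2 := h.per (-(t + 2 * Kpq p q k))
    rw [h.odd (t + _)] at h2
    rw [show 2 * Kpq p q k - (t + 2 * Kpq p q k) = -t by ring, h.odd] at h1
    rw [show 2 * Kpq p q k - t = -(t + 2 * Kpq p q k) + 4 * Kpq p q k by ring, h2, ← h1, neg_neg]
  have hP : Function.Periodic S (4 * Kpq p q k) := h.per
  have hper : Function.Periodic (fun t => S (2 * Kpq p q k - t) = S t) (4 * Kpq p q k) := by
    intro t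
    simp only
    rw [h.per t, show 2 * Kpq p q k - (t + 4 * Kpq p q k) = 2 * Kpq p q k - t - 4 * Kpq p q k by ring,
      hP.sub_eq]
  obtain ⟨y, hy, hyt⟩ := hper.exists_mem_Ico (by linarith) t (-(2 * Kpq p q k))
  rw [hyt]
  rcases le_total 0 y with h0 | h0
  · exact h02 y ⟨h0, by linarith [hy.2]⟩
  · exact h20 y ⟨hy.1, h0⟩

lemma antiperiodic (h : IsSn p q k S) (hK : 0 < Kpq p q k) :
    Function.Antiperiodic S (2 * Kpq p q k) := by
  intro t
  rw [← h.odd t, ← h.reflect hK (-t)]; congr 1; ring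

lemma deriv_antiperiodic (h : IsSn p q k S) (hK : 0 < Kpq p q k) :
    Function.Antiperiodic (deriv S) (2 * Kpq p q k) := by
  intro t
  rw [← deriv_comp_add_const, funext (h.antiperiodic hK), deriv.fun_neg]

lemma deriv_reflect (h : IsSn p q k S) (hK : 0 < Kpq p q k) (t : ℝ) :
    deriv S (2 * Kpq p q k - t) = -deriv S t := by
  have := deriv_comp_const_sub (f := S) (2 * Kpq p q k) t
  rw [funext (h.reflect hK)] at this
  linarith

lemma odeAt_shift (h : IsSn p q k S) (hK : 0 < Kpq p q k) {t : ℝ}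
    (ht : OdeAt p q k S (t - 2 * Kpq p q k)) : OdeAt p q k S t := by
  have e1 : ∀ s, S s = -S (s - 2 * Kpq p q k) := fun s => by
    rw [(h.antiperiodic hK).sub_eq, neg_neg]
  have e2 : ∀ s, deriv S s = -deriv S (s - 2 * Kpq p q k) := fun s => by
    rw [(h.deriv_antiperiodic hK).sub_eq, neg_neg]
  constructor
  · have := (ht.1.comp_sub_const t _).neg
    rw [e2 t]
    exact this.congr_of_eventuallyEq (Eventually.of_forall e1)
  · have := (ht.2.comp_sub_const t _).neg
    refine (this.congr_of_eventuallyEq (Eventually.of_forall fun s => ?_)).congr_deriv ?_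
    · simp only [Pi.neg_apply]; rw [e2 s, phi_neg]
    · rw [e1 t, phi_neg, abs_neg]; ring

open Topology in
lemma odeAt_K (h : IsSn p q k S) (hp : 1 < p) (hq : 1 < q) (hk : k ∈ Ioo (0 : ℝ) 1) :
    OdeAt p q k S (Kpq p q k) := by
  have hK := Kpq_pos hp hq hk
  set K := Kpq p q k with hKdef
  have hd0 : deriv S K = 0 := by
    have := h.deriv_reflect hK K
    rw [show 2 * Kpq p q k - K = K by rw [← hKdef]; ring] at this
    linarith
  have hrefl : Tendsto (fun t => 2 * K - t) (𝓝[≥] K) (𝓝[≤] K) := by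
    have hc : ContinuousWithinAt (fun t => 2 * K - t) (Ici K) K := by fun_prop
    have := hc.tendsto_nhdsWithin (t := Iic K) fun s hs => by
      have : K ≤ s := hs
      show 2 * K - s ≤ K
      linarith
    rwa [show 2 * K - K = K by ring] at this
  have hrefl' : Tendsto (fun t => 2 * K - t) (𝓝[>] K) (𝓝[<] K) := by
    have hc : ContinuousWithinAt (fun t => 2 * K - t) (Ioi K) K := by fun_prop
    have := hc.tendsto_nhdsWithin (t := Iio K) fun s hs => by
      have : K < s := hs
      show 2 * K - s < K
      linarith
    rwa [show 2 * K - K = K by ring] at this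
  have hl := h.continuousWithinAt_K hp hq hk
  have hc : ContinuousAt S K := by
    refine continuousAt_iff_continuous_left_right.2 ⟨hl, ?_⟩
    have := (Tendsto.comp hl hrefl)
    exact this.congr fun t => h.reflect hK t
  have hlt : Tendsto (deriv S) (𝓝[<] K) (𝓝 0) := by
    have h1 : Tendsto (fun t => radicand q k (S t) ^ (1 / p)) (𝓝[<] K) (𝓝 0) := by
      have h2 : ContinuousAt (fun t => radicand q k (S t) ^ (1 / p)) K :=
        ((continuous_radicand hq k).continuousAt.comp hc).rpow_const
          (Or.inr (by positivity))
      have h3 : radicand q k (S K) ^ (1 / p) = 0 := by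
        rw [h.apply_K]; simp only [radicand, abs_one, one_rpow, sub_self, zero_mul]
        exact zero_rpow (by positivity)
      have := h2.tendsto.mono_left (nhdsWithin_le_nhds (s := Iio K))
      rwa [h3] at this
    refine h1.congr' ?_
    filter_upwards [Ioo_mem_nhdsLT (show -K < K by linarith)] with s hs
    exact (h.hasDerivAt_of_mem_Ioo hp hq hk hs).deriv.symm
  have hgt : Tendsto (deriv S) (𝓝[>] K) (𝓝 0) := by
    have := (hlt.comp hrefl').neg
    rw [neg_zero] at this
    refine this.congr fun t => ?_
    simp only [Function.comp]
    rw [h.deriv_reflect hK, neg_neg]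
  have hne : Tendsto (deriv S) (𝓝[≠] K) (𝓝 0) := by
    rw [← Iio_union_Ioi, nhdsWithin_union]; exact hlt.sup hgt
  have hode : ∀ᶠ t in 𝓝[≠] K, OdeAt p q k S t := by
    filter_upwards [mem_nhdsWithin_of_mem_nhds (Ioo_mem_nhds (show -K < K by linarith)
      (show K < 3 * K by linarith)), self_mem_nhdsWithin] with t ht htK
    rcases lt_or_gt_of_ne htK with h1 | h1
    · exact h.odeAt_of_mem_Ioo hp hq hk ⟨ht.1, h1⟩
    · exact h.odeAt_shift hK (h.odeAt_of_mem_Ioo hp hq hk ⟨by linarith, by linarith [ht.2]⟩)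
  have hcd : ContinuousAt (deriv S) K := by
    rw [continuousAt_iff_punctured_nhds, hd0]; exact hne
  constructor
  · rw [hd0]
    exact hasDerivAt_of_eventually_hasDerivAt_of_tendsto hc (hode.mono fun t ht => ht.1) hne
  · refine hasDerivAt_of_eventually_hasDerivAt_of_tendsto
      ((continuous_phi hp).continuousAt.comp hcd) (hode.mono fun t ht => ht.2) ?_
    have hb : Continuous fun x : ℝ =>
        -((p - 1) / p * q * phi q x * (1 + k ^ q - 2 * k ^ q * |x| ^ q)) := by
      have h1 := continuous_phi hq
      have h2 : Continuous fun x : ℝ => |x| ^ q :=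
        continuous_abs.rpow_const fun x => Or.inr (by linarith)
      fun_prop
    exact (hb.continuousAt.comp hc).tendsto.mono_left nhdsWithin_le_nhds

lemma odeAt (h : IsSn p q k S) (hp : 1 < p) (hq : 1 < q) (hk : k ∈ Ioo (0 : ℝ) 1) (t : ℝ) :
    OdeAt p q k S t := by
  have hK := Kpq_pos hp hq hk
  have hper : ∀ s, OdeAt p q k S s → OdeAt p q k S (s + 2 * Kpq p q k) := fun s hs =>
    h.odeAt_shift hK (by rwa [add_sub_cancel_right])
  have hper' : ∀ s, OdeAt p q k S (s + 2 * Kpq p q k) → OdeAt p q k S s := fun s hs => by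
    have hs' := hper _ hs
    have e1 : ∀ s, S s = S (s + 4 * Kpq p q k) := fun s => (h.per s).symm
    have e2 : ∀ s, deriv S s = deriv S (s + 4 * Kpq p q k) := fun s => by
      rw [← deriv_comp_add_const, funext h.per]
    rw [show s + 2 * Kpq p q k + 2 * Kpq p q k = s + 4 * Kpq p q k by ring] at hs'
    constructor
    · have := hs'.1.comp_add_const s _
      rw [e2 s]
      exact this.congr_of_eventuallyEq (Eventually.of_forall e1)
    · have := hs'.2.comp_add_const s _
      rw [e1 s]
      refine this.congr_of_eventuallyEq (Eventually.of_forall fun r => ?_)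
      simp only; rw [e2 r]
  have hperiodic : Function.Periodic (OdeAt p q k S) (2 * Kpq p q k) := fun s =>
    propext ⟨hper' s, hper s⟩
  obtain ⟨y, hy, hyt⟩ := hperiodic.exists_mem_Ioc (by linarith) t (-Kpq p q k)
  rw [hyt]
  rcases lt_or_eq_of_le hy.2 with h1 | h1
  · exact h.odeAt_of_mem_Ioo hp hq hk ⟨hy.1, by linarith⟩
  · rw [h1, show -Kpq p q k + 2 * Kpq p q k = Kpq p q k by ring]
    exact h.odeAt_K hp hq hk

lemma abs_le_one (h : IsSn p q k S) (hp : 1 < p) (hq : 1 < q) (hk : k ∈ Ioo (0 : ℝ) 1) (t : ℝ) :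
    |S t| ≤ 1 := by
  have hK := Kpq_pos hp hq hk
  have hper : Function.Periodic (fun s => |S s|) (2 * Kpq p q k) := fun s => by
    simp only; rw [h.antiperiodic hK s, abs_neg]
  obtain ⟨y, hy, hyt⟩ := hper.exists_mem_Ioc (by linarith) t (-Kpq p q k)
  rw [hyt, abs_le]
  exact (h.mem_Icc hp hq hk ⟨hy.1.le, by linarith [hy.2]⟩).1

lemma apply_nat_mul (h : IsSn p q k S) (hK : 0 < Kpq p q k) (n : ℕ) :
    S (n * (2 * Kpq p q k)) = 0 := by
  have hper : Function.Periodic (fun s => |S s|) (2 * Kpq p q k) := fun s => by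
    simp only; rw [h.antiperiodic hK s, abs_neg]
  have := hper.nat_mul_eq n
  simpa [h.apply_zero] using this

lemma exists_nat_of_apply_eq_zero (h : IsSn p q k S) (hp : 1 < p) (hq : 1 < q)
    (hk : k ∈ Ioo (0 : ℝ) 1) {t : ℝ} (ht : 0 < t) (h0 : S t = 0) :
    ∃ n : ℕ, 1 ≤ n ∧ t = n * (2 * Kpq p q k) := by
  have hK := Kpq_pos hp hq hk
  obtain ⟨m, hm, -⟩ := existsUnique_add_zsmul_mem_Ico (show 0 < 2 * Kpq p q k by linarith) t
    (-Kpq p q k)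
  have hper : Function.Periodic (fun s => |S s|) (2 * Kpq p q k) := fun s => by
    simp only; rw [h.antiperiodic hK s, abs_neg]
  have h1 : S (t + m • (2 * Kpq p q k)) = 0 := by
    have := hper.zsmul m t
    simpa [h0] using this
  have h2 := h.strictMonoOn hp hq hk
  have h3 : t + m • (2 * Kpq p q k) = 0 := h2.injOn ⟨hm.1, by linarith [hm.2]⟩
    ⟨by linarith, by linarith⟩ (by rw [h1, h.apply_zero])
  rw [zsmul_eq_mul] at h3
  have hm0 : m < 0 := by
    by_contra hcon
    have : (0 : ℝ) ≤ m := by exact_mod_cast not_lt.1 hcon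
    nlinarith
  refine ⟨m.natAbs, by omega, ?_⟩
  have : (m.natAbs : ℝ) = -m := by
    rw [Nat.cast_natAbs, abs_of_neg hm0]; push_cast; ring
  rw [this]; linarith

lemma deriv_zero (h : IsSn p q k S) (hp : 1 < p) (hq : 1 < q) (hk : k ∈ Ioo (0 : ℝ) 1) :
    deriv S 0 = 1 := by
  have hK := Kpq_pos hp hq hk
  rw [(h.hasDerivAt_of_mem_Ioo hp hq hk (t := 0) ⟨by linarith, hK⟩).deriv, h.apply_zero, radicand,
    abs_zero, zero_rpow (by linarith)]
  simp

lemma continuous_deriv (h : IsSn p q k S) (hp : 1 < p) (hq : 1 < q) (hk : k ∈ Ioo (0 : ℝ) 1) :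
    Continuous (deriv S) := by
  have h1 : Continuous fun t => phi p (deriv S t) :=
    continuous_iff_continuousAt.2 fun t => (h.odeAt hp hq hk t).2.continuousAt
  have hc : 1 < p / (p - 1) := by rw [lt_div_iff₀ (by linarith)]; linarith
  simpa only [Function.comp_def, phi_conj hp] using (continuous_phi hc).comp h1

end IsSn

lemma IsSn.isSolPair_scaled {p q k : ℝ} {S : ℝ → ℝ} (h : IsSn p q k S) (hp : 1 < p) (hq : 1 < q)
    (hk : k ∈ Ioo (0 : ℝ) 1) (T : ℝ) {a c : ℝ} (hc : 0 < c)
    (ha : |a| ^ q = 2 * k ^ q / (1 + k ^ q)) :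
    IsSolPair p q T (q / (p / (p - 1)) * (1 + k ^ q) * |a| ^ (p - q) * c ^ p)
      (fun t => a * S (c * t)) (fun t => a * c * deriv S (c * t)) := by
  have hk0 : 0 < k ^ q := rpow_pos_of_pos hk.1 _
  have ha0 : a ≠ 0 := by
    rintro rfl
    rw [abs_zero, zero_rpow (by linarith)] at ha
    have : 0 < 2 * k ^ q / (1 + k ^ q) := by positivity
    linarith
  have hlin : ∀ t : ℝ, HasDerivAt (fun t => c * t) c t := fun t => by
    simpa using (hasDerivAt_id t).const_mul c
  refine ⟨fun t _ => ?_, ?_, fun t _ => ?_⟩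
  · have := (((h.odeAt hp hq hk (c * t)).1.comp t (hlin t)).const_mul a).hasDerivWithinAt
      (s := Icc 0 T)
    convert! this using 1
    ring
  · exact (((h.continuous_deriv hp hq hk).comp (continuous_const.mul continuous_id)).const_mul
      (a * c)).continuousOn
  · have := (((h.odeAt hp hq hk (c * t)).2.comp t (hlin t)).const_mul
      (phi p (a * c))).hasDerivWithinAt (s := Ioo 0 T)
    simp only [phi_mul] at this ⊢
    refine this.congr_deriv ?_
    have e1 : phi p a = |a| ^ (p - q) * phi q a := by
      rw [phi_eq, phi_eq, ← mul_assoc, ← rpow_add (abs_pos.2 ha0)]; congr 2; ring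
    have e2 : phi p c * c = c ^ p := by
      rw [phi_of_pos p hc, ← rpow_add_one hc.ne', sub_add_cancel]
    rw [abs_mul, mul_rpow (abs_nonneg a) (abs_nonneg _), ha, e1, ← e2]
    have h1 : p - 1 ≠ 0 := by linarith
    have h2 : p ≠ 0 := by linarith
    field_simp

lemma potential_zero {q : ℝ} (hq : 1 < q) (lam : ℝ) : potential q lam 0 = 0 := by
  simp [potential, zero_rpow (show q ≠ 0 by linarith)]

lemma energy_zero_right {p : ℝ} (hp : 1 < p) (q lam x : ℝ) :
    energy p q lam x 0 = potential q lam x := by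
  simp [energy, zero_rpow (show p ≠ 0 by linarith)]

lemma potential_pos {q lam x : ℝ} (hq : 1 < q) (hlam : 0 < lam) (hx : x ≠ 0) (hx1 : |x| ≤ 1) :
    0 < potential q lam x := by
  have h1 : 0 < |x| ^ q := rpow_pos_of_pos (abs_pos.2 hx) _
  have h2 : |x| ^ q ≤ 1 := rpow_le_one (abs_nonneg x) hx1 (by linarith)
  exact mul_pos (by positivity) (by nlinarith)

lemma IsSolPair.deriv_eq_zero_of_isMaxOn {p q T lam : ℝ} {u v : ℝ → ℝ}
    (h : IsSolPair p q T lam u v) (hu0 : u 0 = 0) (huT : u T = 0) {s : ℝ} (hs : s ∈ Icc 0 T)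
    (hmax : ∀ t ∈ Icc 0 T, |u t| ≤ |u s|) (hne : u s ≠ 0) : v s = 0 := by
  have h0 : 0 < s := lt_of_le_of_ne hs.1 fun e => hne (by rwa [← e])
  have h1 : s < T := lt_of_le_of_ne hs.2 fun e => hne (by rwa [e])
  have hd := (h.1 s hs).hasDerivAt (Icc_mem_nhds h0 h1)
  rcases lt_or_gt_of_ne hne with hneg | hpos
  · refine IsLocalMin.hasDerivAt_eq_zero ?_ hd
    filter_upwards [Icc_mem_nhds h0 h1] with t ht
    have := hmax t ht
    rw [abs_of_neg hneg] at this
    linarith [neg_abs_le (u t)]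
  · refine IsLocalMax.hasDerivAt_eq_zero ?_ hd
    filter_upwards [Icc_mem_nhds h0 h1] with t ht
    have := hmax t ht
    rw [abs_of_pos hpos] at this
    exact (le_abs_self _).trans this

lemma IsSolPair.exists_isMaxOn {p q T lam : ℝ} (hT : 0 < T) {u v : ℝ → ℝ}
    (h : IsSolPair p q T lam u v) (hnt : ¬ ∀ t ∈ Icc (0 : ℝ) T, u t = 0) :
    ∃ s ∈ Icc 0 T, (∀ t ∈ Icc 0 T, |u t| ≤ |u s|) ∧ u s ≠ 0 := by
  obtain ⟨s, hs, hmax⟩ := isCompact_Icc.exists_isMaxOn (nonempty_Icc.2 hT.le) h.continuousOn.abs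
  refine ⟨s, hs, fun t ht => hmax ht, fun h0 => hnt fun t ht => ?_⟩
  have : |u t| ≤ |u s| := hmax ht
  rw [h0, abs_zero] at this
  exact abs_nonpos_iff.1 this

/-- A solution staying below `1` is a rescaled generalized sine function. -/
lemma IsSolPair.exists_eq_sn {p q T lam : ℝ} (hp : 1 < p) (hq : 1 < q) (hT : 0 < T)
    (hlam : 0 < lam) {sn : ℝ → ℝ → ℝ} (hsn : ∀ k ∈ Ioo (0 : ℝ) 1, IsSn p q k (sn k))
    {u v : ℝ → ℝ} (h : IsSolPair p q T lam u v) (hu0 : u 0 = 0) (huT : u T = 0)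
    (hnt : ¬ ∀ t ∈ Icc (0 : ℝ) T, u t = 0) (hlt : ∀ t ∈ Icc (0 : ℝ) T, |u t| < 1) :
    ∃ k ∈ Ioo (0 : ℝ) 1, ∃ n : ℕ, 1 ≤ n ∧ ∃ a : ℝ, |a| ^ q = 2 * k ^ q / (1 + k ^ q) ∧
      lam = q / (p / (p - 1)) * (1 + k ^ q) * |a| ^ (p - q) * (2 * n * Kpq p q k / T) ^ p ∧
      ∀ t ∈ Icc 0 T, u t = a * sn k (2 * n * Kpq p q k / T * t) := by
  obtain ⟨s, hs, hmax, hus⟩ := h.exists_isMaxOn hT hnt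
  have hvs := h.deriv_eq_zero_of_isMaxOn hu0 huT hs hmax hus
  have h0T : (0 : ℝ) ∈ Icc 0 T := left_mem_Icc.2 hT.le
  have hp1 : 0 < p - 1 := by linarith
  have hp0 : 0 < p := by linarith
  have hq0 : 0 < q := by linarith
  have hRpos : 0 < |u s| := abs_pos.2 hus
  have hR1 : |u s| < 1 := hlt s hs
  have hE0 : 0 < potential q lam (u s) := potential_pos hq hlam hus hR1.le
  have hE : ∀ t ∈ Icc 0 T, energy p q lam (u t) (v t) = potential q lam (u s) := by
    intro t ht
    rw [h.energy_const hp hq ht hs, hvs, energy_zero_right hp]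
  set R := |u s| with hR
  have hRq : 0 < R ^ q := rpow_pos_of_pos hRpos _
  have hRq1 : R ^ q < 1 := rpow_lt_one hRpos.le hR1 hq0
  set k := (R ^ q / (2 - R ^ q)) ^ (1 / q) with hkdef
  have hkb : 0 < R ^ q / (2 - R ^ q) := div_pos hRq (by linarith)
  have hk : k ∈ Ioo (0 : ℝ) 1 := by
    refine ⟨rpow_pos_of_pos hkb _, rpow_lt_one hkb.le ?_ (by positivity)⟩
    rw [div_lt_one (by linarith)]; linarith
  have hkq : k ^ q = R ^ q / (2 - R ^ q) := by
    rw [hkdef, ← rpow_mul hkb.le, one_div_mul_cancel hq0.ne', rpow_one]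
  have h2R : 2 - R ^ q ≠ 0 := by linarith
  have hk1 : 1 + k ^ q = 2 / (2 - R ^ q) := by rw [hkq]; field_simp; ring
  have hRk : R ^ q = 2 * k ^ q / (1 + k ^ q) := by rw [hk1, hkq]; field_simp
  have hkq0 : 0 < k ^ q := rpow_pos_of_pos hk.1 _
  set M := q / (p / (p - 1)) * (1 + k ^ q) * R ^ (p - q) with hM
  have hMpos : 0 < M := by
    have := rpow_pos_of_pos hRpos (p - q)
    positivity
  set c := (lam / M) ^ (1 / p) with hc
  have hcpos : 0 < c := by positivity
  have hcp : c ^ p = lam / M := by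
    rw [hc, ← rpow_mul (by positivity), one_div_mul_cancel hp0.ne', rpow_one]
  have hlamM : lam = M * c ^ p := by rw [hcp]; field_simp
  have hv0 : |v 0| = R * c := by
    have h1 := hE 0 h0T
    rw [energy, hu0, potential_zero hq, add_zero, potential, ← hR] at h1
    have h2 : (R * c) ^ p = |v 0| ^ p := by
      have h3 : R ^ p = R ^ (p - q) * R ^ q := by rw [← rpow_add hRpos, sub_add_cancel]
      have h4 : |v 0| ^ p = p / (p - 1) * (lam / q * (R ^ q - (R ^ q) ^ 2 / 2)) := by
        rw [← h1]; field_simp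
      have h5 := (rpow_pos_of_pos hRpos (p - q)).ne'
      rw [mul_rpow hRpos.le hcpos.le, hcp, h4, hM, h3, hk1]
      field_simp
    have := (Real.rpow_left_inj (by positivity) (abs_nonneg (v 0)) hp0.ne').1 h2
    exact this.symm
  have hv0c : ∃ a : ℝ, |a| = R ∧ v 0 = a * c := by
    refine ⟨v 0 / c, ?_, by field_simp⟩
    rw [abs_div, hv0, abs_of_pos hcpos]; field_simp
  obtain ⟨a, haR, hva⟩ := hv0c
  have hS := hsn k hk
  have hpair := hS.isSolPair_scaled hp hq hk T hcpos (a := a) (by rw [haR, hRk])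
  rw [haR, ← hM, ← hlamM] at hpair
  have heq := h.eqOn hp hq hlam.ne' hpair (by simp [hu0, hS.apply_zero])
    (by simp [hva, hS.deriv_zero hp hq hk])
    (abs_pos.1 (by rw [hv0]; positivity)) (fun t ht hvt => by
      refine ⟨fun hut => ?_, (rpow_lt_one (abs_nonneg _) (hlt t ht) hq0).ne⟩
      have := hE t ht
      rw [hvt, hut, energy_zero_right hp, potential_zero hq] at this
      linarith)
  have ha0 : a ≠ 0 := abs_pos.1 (by rw [haR]; exact hRpos)
  have hST : sn k (c * T) = 0 := by
    have := heq T (right_mem_Icc.2 hT.le)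
    rw [huT] at this
    exact (mul_eq_zero.1 this.symm).resolve_left ha0
  obtain ⟨n, hn, hcn⟩ := hS.exists_nat_of_apply_eq_zero hp hq hk (mul_pos hcpos hT) hST
  have hc' : 2 * n * Kpq p q k / T = c := by rw [div_eq_iff hT.ne', hcn]; ring
  exact ⟨k, hk, n, hn, a, by rw [haR, hRk], by rw [hc', haR, ← hM, hlamM], by rwa [hc']⟩

lemma one_sub_rpow_le {q x : ℝ} (hq : 1 < q) (hx : x ∈ Icc (0 : ℝ) 1) :
    1 - x ^ q ≤ q * (1 - x) := by
  have := one_add_mul_self_le_rpow_one_add (s := x - 1) (by linarith [hx.1]) hq.le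
  rw [add_sub_cancel] at this
  linarith

/-- For `p ≤ 2`, the level of the equilibria `±1` is not attained. -/
lemma IsSolPair.abs_lt_one {p q T lam : ℝ} (hp : 1 < p) (hp2 : p ≤ 2) (hq : 1 < q) (hT : 0 < T)
    (hlam : 0 < lam) {u v : ℝ → ℝ} (h : IsSolPair p q T lam u v) (hu0 : u 0 = 0) (huT : u T = 0) :
    ∀ t ∈ Icc (0 : ℝ) T, |u t| < 1 := by
  by_contra hcon
  push Not at hcon
  obtain ⟨r, hr, hr1⟩ := hcon
  have hp1 : 0 < p - 1 := by linarith
  have hp0 : 0 < p := by linarith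
  have hq0 : 0 < q := by linarith
  have h0T : (0 : ℝ) ∈ Icc 0 T := left_mem_Icc.2 hT.le
  obtain ⟨s, hs, hmax, hus⟩ := h.exists_isMaxOn hT fun hz => by
    rw [hz r hr, abs_zero] at hr1; linarith
  have hvs := h.deriv_eq_zero_of_isMaxOn hu0 huT hs hmax hus
  have hE : ∀ t ∈ Icc 0 T, (p - 1) / p * |v t| ^ p =
      lam / (2 * q) * ((1 - |u t| ^ q) ^ 2 - (1 - |u s| ^ q) ^ 2) := by
    intro t ht
    have h1 := h.energy_const hp hq ht hs
    rw [hvs, energy_zero_right hp, energy, potential, potential] at h1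
    rw [← sub_eq_zero] at h1 ⊢
    rw [← h1]
    field_simp; ring
  have hs1 : 1 ≤ |u s| := hr1.trans (hmax r hr)
  have hRs : |u s| ^ q = 1 := by
    obtain ⟨t, ht, ht1⟩ : (1 : ℝ) ∈ (fun t => |u t|) '' Icc 0 s := by
      refine intermediate_value_Icc hs.1 (h.continuousOn.abs.mono (Icc_subset_Icc_right hs.2)) ?_
      simp only [hu0, abs_zero]
      exact ⟨zero_le_one, hs1⟩
    simp only at ht1
    have h1 := hE t ⟨ht.1, ht.2.trans hs.2⟩
    rw [ht1, one_rpow, sub_self, zero_pow two_ne_zero, zero_sub] at h1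
    have h2 : 0 ≤ (p - 1) / p * |v t| ^ p :=
      mul_nonneg (by positivity) (rpow_nonneg (abs_nonneg _) _)
    have h3 : 0 ≤ lam / (2 * q) * (1 - |u s| ^ q) ^ 2 := by positivity
    have h4 : lam / (2 * q) * (1 - |u s| ^ q) ^ 2 = 0 := by linarith
    have h5 := (mul_eq_zero.1 h4).resolve_left (by positivity)
    have := pow_eq_zero_iff two_ne_zero |>.1 h5
    linarith
  have hs1' : |u s| = 1 := by
    refine le_antisymm ?_ hs1
    by_contra hlt
    have := one_lt_rpow (not_le.1 hlt) hq0
    linarith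
  set D := (p / (p - 1) * (lam / (2 * q))) ^ (1 / p) with hD
  have hD0 : 0 ≤ D := by positivity
  have hvb : ∀ t ∈ Icc 0 T, |v t| ≤ D * q * (1 - |u t|) := by
    intro t ht
    have hu1 : |u t| ≤ 1 := hs1' ▸ hmax t ht
    have hy0 : 0 ≤ 1 - |u t| ^ q := by
      have := rpow_le_one (abs_nonneg (u t)) hu1 hq0.le; linarith
    have hy1 : 1 - |u t| ^ q ≤ 1 := by
      have := rpow_nonneg (abs_nonneg (u t)) q; linarith
    have h1 := hE t ht
    rw [hRs, sub_self, zero_pow two_ne_zero, sub_zero] at h1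
    have h2 : |v t| ^ p ≤ (D * (1 - |u t| ^ q)) ^ p := by
      rw [mul_rpow hD0 hy0, hD, ← rpow_mul (by positivity), one_div_mul_cancel hp0.ne', rpow_one]
      have h3 : (1 - |u t| ^ q) ^ 2 ≤ (1 - |u t| ^ q) ^ p := by
        rw [← rpow_two]
        exact rpow_le_rpow_of_exponent_ge' hy0 hy1 hp0.le hp2
      have h4 : |v t| ^ p = p / (p - 1) * (lam / (2 * q)) * (1 - |u t| ^ q) ^ 2 := by
        rw [mul_assoc, ← h1]; field_simp
      rw [h4]
      exact mul_le_mul_of_nonneg_left h3 (by positivity)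
    have h5 := (rpow_le_rpow_iff (abs_nonneg (v t)) (mul_nonneg hD0 hy0) hp0).1 h2
    refine h5.trans ?_
    rw [mul_assoc]
    exact mul_le_mul_of_nonneg_left (one_sub_rpow_le hq ⟨abs_nonneg _, hu1⟩) hD0
  obtain ⟨e, he, hes⟩ : ∃ e : ℝ, |e| = 1 ∧ e * u s = 1 := by
    rcases abs_eq zero_le_one |>.1 hs1' with h1 | h1
    · exact ⟨1, by simp, by simp [h1]⟩
    · exact ⟨-1, by simp, by simp [h1]⟩
  have hzero := eq_zero_of_abs_deriv_le_mul_abs_self_of_eq_zero_right (K := D * q)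
    (f := fun t => 1 - e * u (s - t)) (f' := fun t => e * v (s - t)) (a := 0) (b := s) ?_ ?_
    (by simp [hes]) ?_ s (right_mem_Icc.2 hs.1)
  · simp [hu0] at hzero
  · refine continuousOn_const.sub (continuousOn_const.mul (h.continuousOn.comp ?_ ?_))
    · fun_prop
    · intro t ht; exact ⟨by linarith [ht.2], by linarith [ht.1, hs.2]⟩
  · intro t ht
    have hst : s - t ∈ Icc 0 T := ⟨by linarith [ht.2], by linarith [ht.1, hs.2]⟩
    have hin : HasDerivWithinAt (fun t => s - t) (-1) (Icc t s) t :=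
      ((hasDerivAt_id t).const_sub s).hasDerivWithinAt
    have h1 : HasDerivWithinAt (fun t => u (s - t)) (v (s - t) * -1) (Icc t s) t :=
      (h.1 (s - t) hst).comp t hin fun r hr =>
        ⟨by linarith [hr.2], by linarith [hr.1, ht.1, hs.2]⟩
    have h2 := (h1.const_mul e).const_sub 1
    refine (h2.mono_of_mem_nhdsWithin (Icc_mem_nhdsGE ht.2)).congr_deriv ?_
    ring
  · intro t ht
    have hst : s - t ∈ Icc 0 T := ⟨by linarith [ht.2], by linarith [ht.1, hs.2]⟩
    have hDq : 0 ≤ D * q := by positivity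
    rw [norm_mul, Real.norm_eq_abs, Real.norm_eq_abs, he, one_mul]
    refine (hvb _ hst).trans (mul_le_mul_of_nonneg_left ?_ hDq)
    have : e * u (s - t) ≤ |u (s - t)| := by
      calc e * u (s - t) ≤ |e * u (s - t)| := le_abs_self _
        _ = |u (s - t)| := by rw [abs_mul, he, one_mul]
    have h3 := le_abs_self (1 - e * u (s - t))
    rw [Real.norm_eq_abs]
    linarith

theorem stmt13 (p q T : ℝ) (hp : 1 < p) (hq : 1 < q) (hT : 0 < T)
    (sn : ℝ → ℝ → ℝ)
    (hsn_inv : ∀ k ∈ Ico (0:ℝ) 1, ∀ σ ∈ Icc (0:ℝ) 1, sn k (arcsnPQ p q k σ) = σ)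
    (hsn_refl : ∀ k ∈ Ico (0:ℝ) 1, ∀ t ∈ Icc (Kpq p q k) (2 * Kpq p q k),
      sn k t = sn k (2 * Kpq p q k - t))
    (hsn_odd : ∀ k ∈ Ico (0:ℝ) 1, ∀ t : ℝ, sn k (-t) = - sn k t)
    (hsn_per : ∀ k ∈ Ico (0:ℝ) 1, ∀ t : ℝ, sn k (t + 4 * Kpq p q k) = sn k t) :
    let lamn := fun (n : ℕ) (k : ℝ) =>
      q / (p / (p - 1)) * (1 + k ^ q) * (2 * k ^ q / (1 + k ^ q)) ^ (p / q - 1) *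
        (2 * (n : ℝ) * Kpq p q k / T) ^ p
    let un := fun (n : ℕ) (k : ℝ) (t : ℝ) =>
      (2 * k ^ q / (1 + k ^ q)) ^ (1 / q) * sn k (2 * (n : ℝ) * Kpq p q k * t / T)
    (∀ k ∈ Ioo (0:ℝ) 1, ∀ n : ℕ, 1 ≤ n →
      IsSolP p q T (lamn n k) (un n k) ∧
      IsSolP p q T (lamn n k) (fun t => -(un n k t)) ∧
      (¬ ∀ t ∈ Icc (0:ℝ) T, un n k t = 0) ∧
      (∀ t : ℝ, |un n k t| < 1)) ∧
    (p ≤ 2 → ∀ lam : ℝ, 0 < lam → ∀ u : ℝ → ℝ, IsSolP p q T lam u →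
      (¬ ∀ t ∈ Icc (0:ℝ) T, u t = 0) →
      ∃ n : ℕ, 1 ≤ n ∧ ∃ k ∈ Ioo (0:ℝ) 1, lam = lamn n k ∧
        ((∀ t ∈ Icc (0:ℝ) T, u t = un n k t) ∨
         (∀ t ∈ Icc (0:ℝ) T, u t = -(un n k t)))) ∧
    (2 < p → ∀ lam : ℝ, 0 < lam → ∀ u : ℝ → ℝ, IsSolP p q T lam u →
      (¬ ∀ t ∈ Icc (0:ℝ) T, u t = 0) →
      (∀ t ∈ Icc (0:ℝ) T, |u t| < 1) →
      ∃ n : ℕ, 1 ≤ n ∧ ∃ k ∈ Ioo (0:ℝ) 1, lam = lamn n k ∧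
        ((∀ t ∈ Icc (0:ℝ) T, u t = un n k t) ∨
         (∀ t ∈ Icc (0:ℝ) T, u t = -(un n k t)))) := by
  intro lamn un
  have hsn : ∀ k ∈ Ioo (0 : ℝ) 1, IsSn p q k (sn k) := fun k hk =>
    ⟨hsn_inv k (Ioo_subset_Ico_self hk), hsn_refl k (Ioo_subset_Ico_self hk),
      hsn_odd k (Ioo_subset_Ico_self hk), hsn_per k (Ioo_subset_Ico_self hk)⟩
  have hq0 : q ≠ 0 := by linarith
  have hbase : ∀ k ∈ Ioo (0 : ℝ) 1, 0 < 2 * k ^ q / (1 + k ^ q) ∧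
      2 * k ^ q / (1 + k ^ q) < 1 := fun k hk => by
    have h0 : 0 < k ^ q := rpow_pos_of_pos hk.1 _
    have h1 : k ^ q < 1 := rpow_lt_one hk.1.le hk.2 (by linarith)
    exact ⟨by positivity, by rw [div_lt_one (by linarith)]; linarith⟩
  have hamp : ∀ k ∈ Ioo (0 : ℝ) 1,
      |(2 * k ^ q / (1 + k ^ q)) ^ (1 / q)| ^ q = 2 * k ^ q / (1 + k ^ q) := fun k hk => by
    have h0 := (hbase k hk).1
    rw [abs_of_pos (rpow_pos_of_pos h0 _), ← rpow_mul h0.le, one_div_mul_cancel hq0, rpow_one]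
  have hroot : ∀ k ∈ Ioo (0 : ℝ) 1, ∀ a : ℝ, |a| ^ q = 2 * k ^ q / (1 + k ^ q) →
      |a| = (2 * k ^ q / (1 + k ^ q)) ^ (1 / q) := fun k hk a ha => by
    rw [← ha, ← rpow_mul (abs_nonneg a), mul_one_div_cancel hq0, rpow_one]
  have hlamn : ∀ k ∈ Ioo (0 : ℝ) 1, ∀ n : ℕ, ∀ a : ℝ, |a| ^ q = 2 * k ^ q / (1 + k ^ q) →
      q / (p / (p - 1)) * (1 + k ^ q) * |a| ^ (p - q) * (2 * n * Kpq p q k / T) ^ p =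
        lamn n k := fun k hk n a ha => by
    rw [hroot k hk a ha, ← rpow_mul (hbase k hk).1.le]
    simp only [lamn]
    congr 3; field_simp
  have harg : ∀ (n : ℕ) (k t : ℝ), 2 * n * Kpq p q k / T * t = 2 * n * Kpq p q k * t / T :=
    fun n k t => by ring
  have hconv : ∀ lam : ℝ, 0 < lam → ∀ u : ℝ → ℝ, IsSolP p q T lam u →
      (¬ ∀ t ∈ Icc (0:ℝ) T, u t = 0) → (∀ t ∈ Icc (0:ℝ) T, |u t| < 1) →
      ∃ n : ℕ, 1 ≤ n ∧ ∃ k ∈ Ioo (0:ℝ) 1, lam = lamn n k ∧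
        ((∀ t ∈ Icc (0:ℝ) T, u t = un n k t) ∨
         (∀ t ∈ Icc (0:ℝ) T, u t = -(un n k t))) := by
    rintro lam hlam u ⟨v, h1, h2, h3, hu0, huT⟩ hnt hlt
    have hpair : IsSolPair p q T lam u v := ⟨h1, h2, h3⟩
    obtain ⟨k, hk, n, hn, a, ha, hl, hu⟩ := hpair.exists_eq_sn hp hq hT hlam hsn hu0 huT hnt hlt
    refine ⟨n, hn, k, hk, hl.trans (hlamn k hk n a ha), ?_⟩
    have habs := hroot k hk a ha
    rcases (abs_eq (rpow_pos_of_pos (hbase k hk).1 _).le).1 habs with h | h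
    · left
      intro t ht
      rw [hu t ht, h, harg]
    · right
      intro t ht
      rw [hu t ht, h, harg, neg_mul]
  refine ⟨fun k hk n hn => ?_, fun hp2 lam hlam u hu hnt => ?_, fun _ => hconv⟩
  · have hS := hsn k hk
    have hK := Kpq_pos hp hq hk
    have hn0 : (0 : ℝ) < n := by exact_mod_cast hn
    have hc : 0 < 2 * n * Kpq p q k / T := by positivity
    have hsol : ∀ a : ℝ, |a| ^ q = 2 * k ^ q / (1 + k ^ q) →
        IsSolP p q T (lamn n k) fun t => a * sn k (2 * n * Kpq p q k * t / T) := by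
      intro a ha
      have h := hS.isSolPair_scaled hp hq hk T hc ha
      rw [hlamn k hk n a ha] at h
      simp only [harg] at h
      refine ⟨_, h.1, h.2.1, h.2.2, by simp [hS.apply_zero], ?_⟩
      have := hS.apply_nat_mul hK n
      beta_reduce
      rw [mul_div_cancel_right₀ _ hT.ne',
        show 2 * (n : ℝ) * Kpq p q k = n * (2 * Kpq p q k) by ring, this, mul_zero]
    refine ⟨hsol _ (hamp k hk), ?_, fun h0 => ?_, fun t => ?_⟩
    · have := hsol (-(2 * k ^ q / (1 + k ^ q)) ^ (1 / q)) (by rw [abs_neg, hamp k hk])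
      simpa only [un, neg_mul] using this
    · have hn1 : (1 : ℝ) ≤ n := by exact_mod_cast hn
      have := h0 (T / (2 * n)) ⟨by positivity, div_le_self hT.le (by linarith)⟩
      simp only [un] at this
      rw [show 2 * (n : ℝ) * Kpq p q k * (T / (2 * n)) / T = Kpq p q k by field_simp, hS.apply_K,
        mul_one] at this
      exact (rpow_pos_of_pos (hbase k hk).1 _).ne' this
    · simp only [un]
      have h1 : (2 * k ^ q / (1 + k ^ q)) ^ (1 / q) < 1 :=
        rpow_lt_one (hbase k hk).1.le (hbase k hk).2 (by positivity)
      have h2 := rpow_pos_of_pos (hbase k hk).1 (1 / q)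
      rw [abs_mul, abs_of_pos h2]
      calc _ ≤ (2 * k ^ q / (1 + k ^ q)) ^ (1 / q) * 1 :=
            mul_le_mul_of_nonneg_left (hS.abs_le_one hp hq hk _) h2.le
        _ < 1 := by linarith
  · obtain ⟨v, h1, h2, h3, hu0, huT⟩ := id hu
    have hpair : IsSolPair p q T lam u v := ⟨h1, h2, h3⟩
    exact hconv lam hlam u hu hnt (hpair.abs_lt_one hp hp2 hq hT hlam hu0 huT)
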